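/- arXiv:1901.00973 — 4 statements merged into one kernel-verified Lean document; each statement's English description precedes it below -/
import Mathlib

section
/- Let n ≥ 1 and let Ω₁ = {λ = (λ₀,…,λₙ) ∈ ℝ^{n+1} : 2 < λᵢ − 2i < 3 for i = 0,…,n−1, and λₙ > 2n+2}. For λ ∈ Ω₁ let P(λ) be the (n+1)×(n+1) real matrix with entries P(λ)_{i,j} = (−λ_j)^{i−n} (rows i = 0,…,n, columns j = 0,…,n), and let (d₀,…,dₙ)ᵀ = P(λ)^{−1}(0,…,0,1)ᵀ be the last column of P(λ)^{−1}. Then the quantities c₁ = sup_{λ∈Ω₁} ‖P(λ)‖, c₂ = sup_{λ∈Ω₁} ‖P(λ)‖·‖P(λ)^{−1}‖, c₃ = sup_{λ∈Ω₁} √n·(2n+1)·dₙ, and c₄(i) = sup_{λ∈Ω₁} |(2n+1)·n·λₙ·dᵢ| for i = 0,…,n−1 are all finite, and hence c₀ = max{c₁, c₂, c₃, c₄(0),…,c₄(n−1)} is a finite positive number. -/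
/-- Operator norm of a square real matrix induced by the Euclidean norm. -/
noncomputable def opNorm {m : ℕ} (A : Matrix (Fin m) (Fin m) ℝ) : ℝ :=
  ‖Matrix.toEuclideanCLM (𝕜 := ℝ) A‖

/-- The parameter set Ω₁ = {λ : 2 < λᵢ − 2i < 3 for i < n, λₙ > 2n+2}. -/
def Omega1 (n : ℕ) : Set (Fin (n+1) → ℝ) :=
  {l | (∀ i : Fin (n+1), (i : ℕ) < n → 2 < l i - 2*(i:ℕ) ∧ l i - 2*(i:ℕ) < 3) ∧
       2*(n:ℝ) + 2 < l (Fin.last n)}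

/-- The matrix P(λ) with entries P(λ)_{i,j} = (−λ_j)^{i−n}. -/
noncomputable def Pmat (n : ℕ) (l : Fin (n+1) → ℝ) : Matrix (Fin (n+1)) (Fin (n+1)) ℝ :=
  fun i j => (-(l j)) ^ (((i:ℕ) : ℤ) - (n : ℤ))

/-- (d₀,…,dₙ)ᵀ, the last column of P(λ)⁻¹. -/
noncomputable def dvec (n : ℕ) (l : Fin (n+1) → ℝ) : Fin (n+1) → ℝ :=
  fun i => (Pmat n l)⁻¹ i (Fin.last n)

/-- c₀ = max{c₁, c₂, c₃, c₄(0),…,c₄(n−1)}. -/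
noncomputable def c0 (n : ℕ) : ℝ :=
  max (max (sSup ((fun l => opNorm (Pmat n l)) '' Omega1 n))
           (sSup ((fun l => opNorm (Pmat n l) * opNorm (Pmat n l)⁻¹) '' Omega1 n)))
      (max (sSup ((fun l => Real.sqrt n * (2*(n:ℝ)+1) * dvec n l (Fin.last n)) '' Omega1 n))
           (⨆ i : Fin n, sSup ((fun l => |(2*(n:ℝ)+1) * (n:ℝ) * l (Fin.last n) * dvec n l i.castSucc|) '' Omega1 n)))

/-- The Vandermonde matrix with nodes `x`, one column per node, powers decreasing down the rows. -/
def revVandermonde {n : ℕ} (x : Fin (n + 1) → ℝ) : Matrix (Fin (n + 1)) (Fin (n + 1)) ℝ :=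
  fun i j => x j ^ (Fin.rev i : ℕ)

/-- A compact box containing every `-λ⁻¹` with `λ ∈ Omega1 n`. -/
noncomputable def nodeBox (n : ℕ) : Set (Fin (n + 1) → ℝ) :=
  Set.univ.pi fun i : Fin (n + 1) =>
    Set.Icc (-(2 * (i : ℝ) + 2)⁻¹) (if (i : ℕ) < n then -(2 * (i : ℝ) + 3)⁻¹ else 0)

lemma isCompact_nodeBox (n : ℕ) : IsCompact (nodeBox n) :=
  isCompact_univ_pi fun _ => isCompact_Icc

lemma strictMono_of_mem_nodeBox {n : ℕ} {x : Fin (n + 1) → ℝ} (hx : x ∈ nodeBox n) :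
    StrictMono x := by
  intro i j hij
  have hi := (hx i trivial).2
  have hj := (hx j trivial).1
  have hij' : (i : ℕ) < j := hij
  have hin : (i : ℕ) < n := by omega
  simp only [hin, if_true] at hi
  have h1 : (i : ℝ) + 1 ≤ j := by exact_mod_cast hij'
  have h2 : (2 * (j : ℝ) + 2)⁻¹ < (2 * (i : ℝ) + 3)⁻¹ := by
    apply inv_strictAnti₀ (by positivity); linarith
  linarith

lemma pos_of_mem_Omega1 {n : ℕ} {l : Fin (n + 1) → ℝ} (hl : l ∈ Omega1 n) (i : Fin (n + 1)) :
    2 * (i : ℝ) + 2 < l i := by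
  by_cases hi : (i : ℕ) < n
  · linarith [(hl.1 i hi).1]
  · obtain rfl : i = Fin.last n := Fin.ext (by simp; omega)
    simpa using hl.2

lemma neg_inv_mem_nodeBox {n : ℕ} {l : Fin (n + 1) → ℝ} (hl : l ∈ Omega1 n) :
    (fun i => -(l i)⁻¹) ∈ nodeBox n := by
  intro i _
  have h := pos_of_mem_Omega1 hl i
  have h0 : (0 : ℝ) < 2 * (i : ℝ) + 2 := by positivity
  refine ⟨neg_le_neg (inv_anti₀ h0 h.le), ?_⟩
  split_ifs with hi
  · exact neg_le_neg (inv_anti₀ (h0.trans h) (by linarith [(hl.1 i hi).2]))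
  · simpa using (h0.trans h).le

lemma Pmat_eq_revVandermonde (n : ℕ) (l : Fin (n + 1) → ℝ) :
    Pmat n l = revVandermonde fun i => -(l i)⁻¹ := by
  ext i j
  have h : ((i : ℕ) : ℤ) - n = -((Fin.rev i : ℕ) : ℤ) := by
    rw [Fin.val_rev]; omega
  rw [Pmat, revVandermonde, h, zpow_neg, zpow_natCast, ← inv_pow, inv_neg]

lemma det_revVandermonde_ne_zero {n : ℕ} {x : Fin (n + 1) → ℝ} (hx : Function.Injective x) :
    (revVandermonde x).det ≠ 0 := by
  have h : revVandermonde x = (Matrix.vandermonde x).transpose.submatrix Fin.revPerm id := by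
    ext i j; simp [revVandermonde, Matrix.vandermonde]
  rw [h, Matrix.det_permute, Matrix.det_transpose]
  refine mul_ne_zero ?_ (Matrix.det_vandermonde_ne_zero_iff.mpr hx)
  exact_mod_cast (Equiv.Perm.sign (Fin.revPerm (n := n + 1))).ne_zero

lemma continuous_revVandermonde (n : ℕ) :
    Continuous (revVandermonde : (Fin (n + 1) → ℝ) → _) := by
  refine continuous_matrix fun i j => ?_
  unfold revVandermonde
  fun_prop

lemma continuousOn_revVandermonde_inv (n : ℕ) :
    ContinuousOn (fun x : Fin (n + 1) → ℝ => (revVandermonde x)⁻¹) (nodeBox n) := by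
  simp only [Matrix.inv_def, Ring.inverse_eq_inv']
  have hc := continuous_revVandermonde n
  refine ContinuousOn.smul (hc.matrix_det.continuousOn.inv₀ fun x hx => ?_)
    hc.matrix_adjugate.continuousOn
  exact det_revVandermonde_ne_zero (strictMono_of_mem_nodeBox hx).injective

lemma continuous_opNorm {m : ℕ} : Continuous (opNorm : Matrix (Fin m) (Fin m) ℝ → ℝ) :=
  continuous_norm.comp (LinearMap.continuous_of_finiteDimensional
    (Matrix.toEuclideanCLM (n := Fin m) (𝕜 := ℝ)).toAlgEquiv.toLinearMap)

lemma opNorm_pos {m : ℕ} {A : Matrix (Fin m) (Fin m) ℝ} (hA : A ≠ 0) : 0 < opNorm A := by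
  rw [opNorm, norm_pos_iff]
  exact (map_ne_zero_iff _ (Matrix.toEuclideanCLM (n := Fin m) (𝕜 := ℝ)).injective).mpr hA

/-- A function on `Omega1 n` which factors through a continuous function of the nodes `-λ⁻¹`
is bounded above. -/
lemma bddAbove_image_Omega1 {n : ℕ} {f g : (Fin (n + 1) → ℝ) → ℝ}
    (hg : ContinuousOn g (nodeBox n)) (hfg : ∀ l ∈ Omega1 n, f l = g fun i => -(l i)⁻¹) :
    BddAbove (f '' Omega1 n) := by
  refine ((isCompact_nodeBox n).bddAbove_image hg).mono ?_
  rintro _ ⟨l, hl, rfl⟩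
  exact ⟨_, neg_inv_mem_nodeBox hl, (hfg l hl).symm⟩

/-- The last column of the inverse consists of the Lagrange basis polynomials evaluated at `0`. -/
lemma revVandermonde_inv_last {n : ℕ} {x : Fin (n + 1) → ℝ} (hx : Function.Injective x)
    (i : Fin (n + 1)) :
    (revVandermonde x)⁻¹ i (Fin.last n) =
      ∏ k ∈ Finset.univ.erase i, (x i - x k)⁻¹ * (-x k) := by
  set d : Fin (n + 1) → ℝ := fun i => ∏ k ∈ Finset.univ.erase i, (x i - x k)⁻¹ * (-x k)
  have hdet : IsUnit (revVandermonde x).det := (det_revVandermonde_ne_zero hx).isUnit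
  have hmul : (revVandermonde x).mulVec d = Pi.single (Fin.last n) 1 := by
    ext r
    have h := Lagrange.eq_interpolate_of_eval_eq (s := Finset.univ) (v := x)
      (f := (Polynomial.X : Polynomial ℝ) ^ (Fin.rev r : ℕ)) (fun j => x j ^ (Fin.rev r : ℕ))
      hx.injOn (by
        rw [Polynomial.degree_X_pow]; simp only [Finset.card_univ, Fintype.card_fin]
        exact_mod_cast (Fin.rev r).isLt) (by simp)
    have h0 := congrArg (Polynomial.eval 0) h
    rw [Lagrange.interpolate_apply, Polynomial.eval_finsetSum] at h0
    simp only [Polynomial.eval_pow, Polynomial.eval_X, Polynomial.eval_mul, Polynomial.eval_C,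
      Lagrange.basis, Lagrange.basisDivisor, Polynomial.eval_prod, Polynomial.eval_sub,
      zero_sub] at h0
    rw [Matrix.mulVec, dotProduct]
    refine h0.symm.trans ?_
    rw [zero_pow_eq, Pi.single_apply]
    refine if_congr ?_ rfl rfl
    rw [Fin.ext_iff, Fin.val_rev, Fin.val_last]
    omega
  have h := congrArg (fun v => (revVandermonde x)⁻¹.mulVec v i) hmul
  simp only [Matrix.mulVec_mulVec, Matrix.nonsing_inv_mul _ hdet, Matrix.one_mulVec,
    Matrix.mulVec_single_one] at h
  exact h.symm

/-- Lemma 1: the suprema c₁ = sup ‖P(λ)‖, c₂ = sup ‖P(λ)‖‖P(λ)⁻¹‖,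
c₃ = sup √n(2n+1)dₙ and c₄(i) = sup |(2n+1)nλₙdᵢ| over Ω₁ are all finite
(the corresponding sets are bounded above), and hence c₀ is a finite positive number. -/
theorem lemma1_finiteness (n : ℕ) (hn : 1 ≤ n) :
    BddAbove ((fun l => opNorm (Pmat n l)) '' Omega1 n) ∧
    BddAbove ((fun l => opNorm (Pmat n l) * opNorm (Pmat n l)⁻¹) '' Omega1 n) ∧
    BddAbove ((fun l => Real.sqrt n * (2*(n:ℝ)+1) * dvec n l (Fin.last n)) '' Omega1 n) ∧
    (∀ i : Fin n,
      BddAbove ((fun l => |(2*(n:ℝ)+1) * (n:ℝ) * l (Fin.last n) * dvec n l i.castSucc|) '' Omega1 n)) ∧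
    0 < c0 n := by
  have h1 : BddAbove ((fun l => opNorm (Pmat n l)) '' Omega1 n) :=
    bddAbove_image_Omega1
      (continuous_opNorm.comp (continuous_revVandermonde n)).continuousOn
      fun l _ => by rw [Pmat_eq_revVandermonde]; rfl
  refine ⟨h1, ?_, ?_, ?_, ?_⟩
  · refine bddAbove_image_Omega1
      ((continuous_opNorm.comp (continuous_revVandermonde n)).continuousOn.mul
        (continuous_opNorm.comp_continuousOn (continuousOn_revVandermonde_inv n)))
      fun l _ => ?_
    simp only [Pmat_eq_revVandermonde]
    rfl
  · refine bddAbove_image_Omega1 (g := fun x => Real.sqrt n * (2 * (n : ℝ) + 1) *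
      (revVandermonde x)⁻¹ (Fin.last n) (Fin.last n)) ?_ fun l _ => ?_
    · exact continuousOn_const.mul
        ((continuous_apply_apply _ _).comp_continuousOn (continuousOn_revVandermonde_inv n))
    · simp only [dvec, Pmat_eq_revVandermonde]
  · intro i
    have hne : Fin.last n ∈ Finset.univ.erase i.castSucc := by
      simp [Fin.ext_iff, i.isLt.ne']
    refine bddAbove_image_Omega1 (g := fun x => |(2 * (n : ℝ) + 1) * n *
      ((x i.castSucc - x (Fin.last n))⁻¹ *
        ∏ k ∈ (Finset.univ.erase i.castSucc).erase (Fin.last n),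
          (x i.castSucc - x k)⁻¹ * (-x k))|) ?_ fun l hl => ?_
    · have hinv : ∀ k ≠ i.castSucc, ContinuousOn
          (fun x : Fin (n + 1) → ℝ => (x i.castSucc - x k)⁻¹) (nodeBox n) := fun k hk =>
        ContinuousOn.inv₀ (by fun_prop) fun x hx =>
          sub_ne_zero.mpr ((strictMono_of_mem_nodeBox hx).injective.ne hk.symm)
      refine (continuousOn_const.mul ((hinv _ (Finset.ne_of_mem_erase hne)).mul
        (continuousOn_finsetProd _ fun k hk => ?_))).abs
      exact (hinv k (Finset.ne_of_mem_erase (Finset.mem_of_mem_erase hk))).mul (by fun_prop)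
    · have hpos : l (Fin.last n) ≠ 0 := by
        have h := pos_of_mem_Omega1 hl (Fin.last n)
        have h0 : (0 : ℝ) ≤ ((Fin.last n : Fin (n + 1)) : ℕ) := by positivity
        linarith
      simp only [dvec, Pmat_eq_revVandermonde]
      rw [revVandermonde_inv_last
        (strictMono_of_mem_nodeBox (neg_inv_mem_nodeBox hl)).injective,
        ← Finset.mul_prod_erase _ _ hne]
      congr 1
      rw [neg_neg]
      generalize Finset.prod (M := ℝ) _ _ = p
      generalize (_ - _ : ℝ)⁻¹ = q
      field_simp
  · have hl : (fun i : Fin (n + 1) => 2 * (i : ℝ) + 5 / 2) ∈ Omega1 n :=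
      ⟨fun i _ => ⟨by norm_num, by norm_num⟩, by simp; norm_num⟩
    refine lt_of_lt_of_le (opNorm_pos ?_) ((le_csSup h1 ⟨_, hl, rfl⟩).trans
      ((le_max_left _ _).trans (le_max_left _ _)))
    intro h
    simpa [Pmat] using congrFun (congrFun h (Fin.last n)) 0
end

section
/- (Key inequality in Example 2) Let f₁ : ℝ → ℝ and f₂ : ℝ² → ℝ be continuously differentiable with |f₁′(x₁)| ≤ L for all x₁ ∈ ℝ and |f₂(x) − f₂(y)| ≤ L‖x − y‖ for all x, y ∈ ℝ². Define Φ(x₁, x₂) = (x₁, f₁(x₁) + x₂) and F(x₁, x₂) = f₁′(x₁)(f₁(x₁) + x₂) + f₂(x₁, x₂). For a setpoint y* ∈ ℝ let x* = (y*, −f₁(y*)). Then for all x ∈ ℝ²: |F(x) − F(x*)| ≤ √(4L² + (L + L²)²) · ‖Φ(x) − Φ(x*)‖. -/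
/-- The Euclidean norm on the plane is at most the sum of the absolute values. -/
theorem sqrt_sq_add_sq_le_abs_add_abs (a b : ℝ) : √(a ^ 2 + b ^ 2) ≤ |a| + |b| := by
  refine Real.sqrt_le_iff.mpr ⟨by positivity, ?_⟩
  nlinarith [sq_abs a, sq_abs b, mul_nonneg (abs_nonneg a) (abs_nonneg b)]

/-- Cauchy–Schwarz in the plane, with absolute values on the second vector. -/
theorem mul_abs_add_mul_abs_le_sqrt_mul_sqrt (a b c d : ℝ) :
    a * |c| + b * |d| ≤ √(a ^ 2 + b ^ 2) * √(c ^ 2 + d ^ 2) := by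
  rw [← Real.sqrt_mul (by positivity)]
  apply Real.le_sqrt_of_sq_le
  nlinarith [sq_abs c, sq_abs d, sq_nonneg (a * |d| - b * |c|)]

/-- Key inequality in Example 2.  With Φ(x₁,x₂) = (x₁, f₁(x₁)+x₂),
F(x₁,x₂) = f₁′(x₁)(f₁(x₁)+x₂) + f₂(x₁,x₂) and x* = (y*, −f₁(y*)) (so Φ(x*) = (y*,0)),
one has |F(x) − F(x*)| ≤ √(4L² + (L+L²)²)·‖Φ(x) − Φ(x*)‖ (Euclidean norm on ℝ²). -/
theorem example2_key_inequality (L : ℝ) (hL : 0 < L)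
    (f1 : ℝ → ℝ) (f2 : ℝ → ℝ → ℝ)
    (hf1 : ContDiff ℝ 1 f1) (hf2 : ContDiff ℝ 1 (fun p : ℝ × ℝ => f2 p.1 p.2))
    (hf1' : ∀ s : ℝ, |deriv f1 s| ≤ L)
    (hf2Lip : ∀ a b a' b' : ℝ,
      |f2 a b - f2 a' b'| ≤ L * Real.sqrt ((a - a')^2 + (b - b')^2))
    (ystar : ℝ) :
    ∀ x1 x2 : ℝ,
      |(deriv f1 x1 * (f1 x1 + x2) + f2 x1 x2)
        - (deriv f1 ystar * (f1 ystar + (-f1 ystar)) + f2 ystar (-f1 ystar))|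
      ≤ Real.sqrt (4*L^2 + (L + L^2)^2) *
          Real.sqrt ((x1 - ystar)^2 + (f1 x1 + x2)^2) := by
  intro x1 x2
  have hdiff : |f1 x1 - f1 ystar| ≤ L * |x1 - ystar| := by
    simpa [Real.norm_eq_abs] using
      Convex.norm_image_sub_le_of_norm_deriv_le (f := f1) (C := L)
        (fun s _ => (hf1.differentiable one_ne_zero) s)
        (fun s _ => hf1' s) convex_univ (Set.mem_univ ystar) (Set.mem_univ x1)
  have hsnd : |x2 - -f1 ystar| ≤ |f1 x1 + x2| + L * |x1 - ystar| := by
    have h := abs_sub (f1 x1 + x2) (f1 x1 - f1 ystar)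
    rw [show f1 x1 + x2 - (f1 x1 - f1 ystar) = x2 - -f1 ystar by ring] at h
    linarith
  have hf2bound : |f2 x1 x2 - f2 ystar (-f1 ystar)|
      ≤ L * (|x1 - ystar| + (|f1 x1 + x2| + L * |x1 - ystar|)) := by
    refine (hf2Lip _ _ _ _).trans (mul_le_mul_of_nonneg_left ?_ hL.le)
    linarith [sqrt_sq_add_sq_le_abs_add_abs (x1 - ystar) (x2 - -f1 ystar)]
  have hprod : |deriv f1 x1 * (f1 x1 + x2)| ≤ L * |f1 x1 + x2| := by
    rw [abs_mul]
    exact mul_le_mul_of_nonneg_right (hf1' x1) (abs_nonneg _)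
  calc
    _ = |deriv f1 x1 * (f1 x1 + x2) + (f2 x1 x2 - f2 ystar (-f1 ystar))| := by
      congr 1
      ring
    _ ≤ |deriv f1 x1 * (f1 x1 + x2)| + |f2 x1 x2 - f2 ystar (-f1 ystar)| := abs_add_le _ _
    _ ≤ (L + L ^ 2) * |x1 - ystar| + 2 * L * |f1 x1 + x2| := by linarith
    _ ≤ √((L + L ^ 2) ^ 2 + (2 * L) ^ 2) * √((x1 - ystar) ^ 2 + (f1 x1 + x2) ^ 2) :=
      mul_abs_add_mul_abs_le_sqrt_mul_sqrt _ _ _ _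
    _ = _ := by
      congr 2
      ring
end

section
/- (Lower bound inequality in Example 3) Let L ≥ b̲ > 0 and let f₁ : ℝ² → ℝ be continuously differentiable with ‖∇f₁(x)‖ ≤ L and ∂f₁/∂x₂(x) ≥ b̲ for all x ∈ ℝ². Let y* ∈ ℝ and let x₂* be the unique real number with f₁(y*, x₂*) = 0; set x* = (y*, x₂*). Define Φ(x₁, x₂) = (x₁, f₁(x₁, x₂)). Then there exists α > 0, depending only on L and b̲, such that α‖x − x*‖ ≤ ‖Φ(x) − Φ(x*)‖ for all x ∈ ℝ². -/
/-- A differentiable function on `ℝ` whose derivative is at least `m` everywhere expands distances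
by a factor of at least `m`. -/
theorem mul_abs_sub_le_abs_image_sub_of_le_deriv {g : ℝ → ℝ} {m : ℝ} (hg : Differentiable ℝ g)
    (hm : ∀ t, m ≤ deriv g t) (s t : ℝ) : m * |t - s| ≤ |g t - g s| := by
  rcases le_total s t with h | h
  · rw [abs_of_nonneg (sub_nonneg.2 h)]
    exact (mul_sub_le_image_sub_of_le_deriv hg hm h).trans (le_abs_self _)
  · rw [abs_sub_comm t s, abs_of_nonneg (sub_nonneg.2 h), abs_sub_comm]
    exact (mul_sub_le_image_sub_of_le_deriv hg hm h).trans (le_abs_self _)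

/-- If `m * |w| ≤ |v| + L * |u|`, then a multiple of the norm of `(u, w)` bounds the norm of
`(u, v)` from below. -/
theorem sqrt_mul_sqrt_le_sqrt_of_mul_abs_le {m L u v w : ℝ} (hm : 0 ≤ m)
    (h : m * |w| ≤ |v| + L * |u|) :
    √(m ^ 2 / (1 + L ^ 2 + m ^ 2)) * √(u ^ 2 + w ^ 2) ≤ √(u ^ 2 + v ^ 2) := by
  rw [← Real.sqrt_mul (by positivity)]
  apply Real.sqrt_le_sqrt
  rw [div_mul_eq_mul_div, div_le_iff₀ (by positivity)]
  have hsq : (m * |w|) ^ 2 ≤ (|v| + L * |u|) ^ 2 := by gcongr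
  have hcs : (|v| + L * |u|) ^ 2 ≤ (1 + L ^ 2) * (u ^ 2 + v ^ 2) := by
    nlinarith [sq_nonneg (L * |v| - |u|), sq_abs u, sq_abs v]
  rw [mul_pow, sq_abs] at hsq
  nlinarith [mul_nonneg (sq_nonneg m) (sq_nonneg v)]


/-- Lower bound inequality in Example 3.  There is α > 0 depending only on L and b̲
such that for every C¹ function f₁ with ‖∇f₁‖ ≤ L and ∂f₁/∂x₂ ≥ b̲ everywhere,
every setpoint y* and the unique x₂* with f₁(y*, x₂*) = 0 (so Φ(x*) = (y*,0) for
Φ(x₁,x₂) = (x₁, f₁(x₁,x₂)) and x* = (y*,x₂*)):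
α‖x − x*‖ ≤ ‖Φ(x) − Φ(x*)‖ for all x ∈ ℝ². -/
theorem example3_lower_bound (L bl : ℝ) (hbl : 0 < bl) (hblL : bl ≤ L) :
    ∃ α : ℝ, 0 < α ∧
      ∀ f1 : ℝ → ℝ → ℝ, ContDiff ℝ 1 (fun p : ℝ × ℝ => f1 p.1 p.2) →
      (∀ a b : ℝ,
        Real.sqrt ((deriv (fun s => f1 s b) a)^2 + (deriv (fun s => f1 a s) b)^2) ≤ L ∧
        bl ≤ deriv (fun s => f1 a s) b) →
      ∀ ystar x2s : ℝ, f1 ystar x2s = 0 →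
      ∀ a b : ℝ,
        α * Real.sqrt ((a - ystar)^2 + (b - x2s)^2)
          ≤ Real.sqrt ((a - ystar)^2 + (f1 a b)^2) := by
  refine ⟨√(bl ^ 2 / (1 + L ^ 2 + bl ^ 2)), by positivity, ?_⟩
  intro f1 hf hgrad ystar x2s h0 a b
  have hdf : Differentiable ℝ (fun p : ℝ × ℝ => f1 p.1 p.2) := hf.differentiable (by norm_num)
  have hd₁ : Differentiable ℝ (fun s => f1 s x2s) :=
    hdf.comp (differentiable_id.prodMk (differentiable_const x2s))
  have hd₂ : Differentiable ℝ (fun s => f1 a s) :=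
    hdf.comp ((differentiable_const a).prodMk differentiable_id)
  have hlip : |f1 a x2s - f1 ystar x2s| ≤ L * |a - ystar| :=
    convex_univ.norm_image_sub_le_of_norm_deriv_le (fun s _ => hd₁ s)
      (fun s _ => (Real.abs_le_sqrt (by linarith [sq_nonneg (deriv (fun t => f1 s t) x2s)])).trans
        (hgrad s x2s).1) (Set.mem_univ ystar) (Set.mem_univ a)
  have hexp : bl * |b - x2s| ≤ |f1 a b - f1 a x2s| :=
    mul_abs_sub_le_abs_image_sub_of_le_deriv hd₂ (fun s => (hgrad a s).2) x2s b
  apply sqrt_mul_sqrt_le_sqrt_of_mul_abs_le hbl.le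
  rw [h0, sub_zero] at hlip
  linarith [abs_sub (f1 a b) (f1 a x2s)]
end

section
/- (No finite escape under log-linear growth) Let 0 < T < ∞ and let x : [0, T) → ℝⁿ be continuously differentiable. Suppose there exist constants α₁, α₂ > 0 such that ‖ẋ(t)‖ ≤ α₁‖x(t)‖ log‖x(t)‖ + α₂ for every t ∈ [0, T) with ‖x(t)‖ ≥ e (where e is Euler's number). Then sup_{0 ≤ t < T} ‖x(t)‖ < ∞. -/
/-- No finite escape under log-linear growth: if x : [0,T) → ℝⁿ is continuously
differentiable with derivative x′ and ‖x′(t)‖ ≤ α₁‖x(t)‖log‖x(t)‖ + α₂ whenever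
‖x(t)‖ ≥ e, then x is bounded on [0,T). -/
theorem no_finite_escape (n : ℕ) (T : ℝ) (hT : 0 < T)
    (x x' : ℝ → EuclideanSpace ℝ (Fin n))
    (hderiv : ∀ t ∈ Set.Ico (0:ℝ) T, HasDerivWithinAt x (x' t) (Set.Ico 0 T) t)
    (hcont : ContinuousOn x' (Set.Ico 0 T))
    (α₁ α₂ : ℝ) (hα₁ : 0 < α₁) (hα₂ : 0 < α₂)
    (hgrowth : ∀ t ∈ Set.Ico (0:ℝ) T, Real.exp 1 ≤ ‖x t‖ →
      ‖x' t‖ ≤ α₁ * ‖x t‖ * Real.log ‖x t‖ + α₂) :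
    ∃ M : ℝ, ∀ t ∈ Set.Ico (0:ℝ) T, ‖x t‖ ≤ M := by
  set K := α₁ + α₂ with hK
  set C := 1 + ‖x 0‖ with hC
  have hC1 : 1 ≤ C := by simp [hC]
  have hK0 : 0 < K := by positivity
  have hB : ∀ s : ℝ, HasDerivAt (fun s => Real.exp (C * Real.exp (K * s)))
      (Real.exp (C * Real.exp (K * s)) * (C * (Real.exp (K * s) * K))) s := fun s => by
    simpa using ((((hasDerivAt_id s).const_mul K).exp).const_mul C).exp
  refine ⟨Real.exp (C * Real.exp (K * T)), fun t ht => ?_⟩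
  have hsub : Set.Icc 0 t ⊆ Set.Ico 0 T := fun s hs => ⟨hs.1, hs.2.trans_lt ht.2⟩
  have hle : ‖x t‖ ≤ Real.exp (C * Real.exp (K * t)) := by
    refine image_norm_le_of_norm_deriv_right_lt_deriv_boundary (a := 0) (b := t) (f' := x')
      (fun s hs => ((hderiv s (hsub hs)).continuousWithinAt).mono hsub)
      (fun s hs => ?_) ?_ hB (fun s hs heq => ?_) ⟨ht.1, le_rfl⟩
    · have hs' := hsub (Set.Ico_subset_Icc_self hs)
      refine (hderiv s hs').mono_of_mem_nhdsWithin ?_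
      filter_upwards [Ico_mem_nhdsGE hs'.2] with u hu using ⟨hs.1.trans hu.1, hu.2⟩
    · have := Real.add_one_le_exp C
      simp only [mul_zero, Real.exp_zero, mul_one]
      linarith
    · have hexp : 1 ≤ Real.exp (K * s) := Real.one_le_exp (mul_nonneg hK0.le hs.1)
      have hlog : 1 ≤ C * Real.exp (K * s) := one_le_mul_of_one_le_of_one_le hC1 hexp
      have hBe := Real.exp_le_exp.mpr hlog
      have hg := hgrowth s (hsub (Set.Ico_subset_Icc_self hs)) (heq ▸ hBe)
      rw [heq, Real.log_exp] at hg
      have hBlog : 1 < Real.exp (C * Real.exp (K * s)) * (C * Real.exp (K * s)) :=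
        one_lt_mul_of_lt_of_le ((Real.one_lt_exp_iff.mpr one_pos).trans_le hBe) hlog
      have := mul_lt_mul_of_pos_left hBlog hα₂
      refine hg.trans_lt ?_
      calc _ < α₁ * Real.exp (C * Real.exp (K * s)) * (C * Real.exp (K * s))
            + α₂ * (Real.exp (C * Real.exp (K * s)) * (C * Real.exp (K * s))) := by linarith
        _ = (α₁ + α₂) * (Real.exp (C * Real.exp (K * s)) * (C * Real.exp (K * s))) := by ring
        _ = _ := by rw [← hK]; ring
  refine hle.trans ?_
  have := ht.2.le
  gcongr
end
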